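/- Let P ∈ ℝ^{n×n} and Q ∈ ℝ^{p×p} be symmetric positive definite, A_cl ∈ ℝ^{n×n}, D ∈ ℝ^{n×p} with D ≠ 0. Suppose that for all x ∈ ℝ^n and ω ∈ ℝ^p, the implications ωᵀ Q ω ≤ 1 and xᵀ P x = 1 imply xᵀ P (A_cl x + D ω) ≤ 0. Then (assuming n ≥ 3) there exists β > 0 such that [[P A_cl + A_clᵀ P + β P, P D], [Dᵀ P, −β Q]] ⪯ 0. -/

import Mathlib

open Matrix

/-- Two points of the positivity region of a real quadratic form are joined, up to sign, by a
segment inside that region; a second form of opposite signs at them vanishes on it. -/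
theorem QuadraticForm.exists_pos_and_eq_zero {V : Type*} [AddCommGroup V] [Module ℝ V]
    (q f : QuadraticForm ℝ V) {x y : V} (hx : 0 < q x) (hy : 0 < q y)
    (hfx : 0 < f x) (hfy : f y < 0) : ∃ z, 0 < q z ∧ f z = 0 := by
  wlog hp : 0 ≤ QuadraticMap.polar q x y generalizing y
  · refine this (y := -y) (by simpa using hy) (by simpa using hfy) ?_
    rw [QuadraticMap.polar_neg_right]
    linarith
  have expand (g : QuadraticForm ℝ V) (t : ℝ) : g ((1 - t) • x + t • y) =
      (1 - t) ^ 2 * g x + t ^ 2 * g y + (1 - t) * t * QuadraticMap.polar g x y := by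
    rw [QuadraticMap.map_add g, QuadraticMap.map_smul, QuadraticMap.map_smul,
      QuadraticMap.polar_smul_left, QuadraticMap.polar_smul_right]
    simp only [smul_eq_mul]
    ring
  have hcont : ContinuousOn (fun t : ℝ => f ((1 - t) • x + t • y)) (Set.Icc 0 1) := by
    simp only [expand]
    fun_prop
  obtain ⟨t, ⟨ht0, ht1⟩, ht⟩ := intermediate_value_Icc' zero_le_one hcont
    (show (0 : ℝ) ∈ Set.Icc _ _ by simpa using ⟨hfy.le, hfx.le⟩)
  refine ⟨_, ?_, ht⟩
  rw [expand]
  have h1 : 0 ≤ 1 - t := by linarith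
  have h2 : 0 ≤ (1 - t) * t * QuadraticMap.polar q x y := by positivity
  rcases ht0.eq_or_lt with rfl | h0
  · simpa using hx
  · have h3 : 0 < t ^ 2 * q y := by positivity
    have h4 : 0 ≤ (1 - t) ^ 2 * q x := by positivity
    linarith

/-- If `√(m e) ≤ s` pointwise, then a single weight `β` gives `β e + m / β ≤ 2 s`. -/
theorem QuadraticForm.exists_pos_forall_quadratic_nonpos {V : Type*} [AddCommGroup V] [Module ℝ V]
    (e s m : QuadraticForm ℝ V) (he : e.PosDef) (hs : ∀ x, 0 ≤ s x)
    (hsm : ∀ x, m x * e x ≤ s x ^ 2) (hne : ∃ x, 0 < m x) :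
    ∃ β : ℝ, 0 < β ∧ ∀ x, β ^ 2 * e x - 2 * β * s x + m x ≤ 0 := by
  obtain ⟨v, hv⟩ := hne
  have hv0 : v ≠ 0 := by
    rintro rfl
    simp at hv
  let r (x : V) : ℝ := √(s x ^ 2 - m x * e x)
  have hr0 (x : V) : 0 ≤ r x := Real.sqrt_nonneg _
  have hr (x : V) : r x ^ 2 = s x ^ 2 - m x * e x := Real.sq_sqrt (sub_nonneg.2 (hsm x))
  have key {x y : V} (hx : x ≠ 0) (hy : y ≠ 0) :
      (s y - r y) / e y ≤ (s x + r x) / e x := by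
    by_contra! hlt
    obtain ⟨β, hβx, hβy⟩ := exists_between hlt
    have hex := he x hx
    have hey := he y hy
    rw [div_lt_iff₀ hex] at hβx
    rw [lt_div_iff₀ hey] at hβy
    obtain ⟨z, hz, hfz⟩ := QuadraticForm.exists_pos_and_eq_zero
      (β ^ 2 • e - (2 * β) • s + m) (β • e - s) (x := x) (y := y)
      (by
        simp only [_root_.add_apply, _root_.sub_apply, _root_.smul_apply,
          smul_eq_mul]
        refine pos_of_mul_pos_left (b := e x) ?_ hex.le
        nlinarith [hr x, hr0 x])
      (by
        simp only [_root_.add_apply, _root_.sub_apply, _root_.smul_apply,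
          smul_eq_mul]
        refine pos_of_mul_pos_left (b := e y) ?_ hey.le
        nlinarith [hr y, hr0 y])
      (by
        simp only [_root_.sub_apply, _root_.smul_apply, smul_eq_mul]
        linarith [hr0 x])
      (by
        simp only [_root_.sub_apply, _root_.smul_apply, smul_eq_mul]
        linarith [hr0 y])
    have hz0 : z ≠ 0 := by
      rintro rfl
      simp at hz
    simp only [_root_.add_apply, _root_.sub_apply, _root_.smul_apply,
      smul_eq_mul] at hz hfz
    have hez := he z hz0
    have hsz : s z = β * e z := by linarith
    have hmz := hsm z
    rw [hsz] at hz hmz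
    nlinarith [mul_pos hz hez]
  let L : Set ℝ := {b | ∃ y, y ≠ 0 ∧ b = (s y - r y) / e y}
  have hub {x : V} (hx : x ≠ 0) : (s x + r x) / e x ∈ upperBounds L := by
    rintro _ ⟨y, hy, rfl⟩
    exact key hx hy
  have hle {x : V} (hx : x ≠ 0) : (s x - r x) / e x ≤ sSup L :=
    le_csSup ⟨_, hub hv0⟩ ⟨x, hx, rfl⟩
  refine ⟨sSup L, lt_of_lt_of_le ?_ (hle hv0), fun x => ?_⟩
  · refine div_pos ?_ (he v hv0)
    nlinarith [hr v, hr0 v, hs v, mul_pos hv (he v hv0)]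
  · rcases eq_or_ne x 0 with rfl | hx
    · simp
    have hex := he x hx
    have hlo := hle hx
    have hhi : sSup L ≤ (s x + r x) / e x := csSup_le ⟨_, v, hv0, rfl⟩ (hub hx)
    rw [div_le_iff₀ hex] at hlo
    rw [le_div_iff₀ hex] at hhi
    refine nonpos_of_mul_nonpos_left (b := e x) ?_ hex
    nlinarith [hr x, mul_nonneg (sub_nonneg.2 hlo) (sub_nonneg.2 hhi)]

theorem Matrix.toQuadraticForm'_apply_eq_dotProduct {ι : Type*} [Fintype ι] [DecidableEq ι]
    (M : Matrix ι ι ℝ) (x : ι → ℝ) : M.toQuadraticForm' x = x ⬝ᵥ (M *ᵥ x) := by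
  simp [Matrix.toQuadraticForm', Matrix.toLinearMap₂'_apply']

theorem stmt15 {n p : ℕ} (hn : 3 ≤ n)
    (P : Matrix (Fin n) (Fin n) ℝ) (Q : Matrix (Fin p) (Fin p) ℝ)
    (hP : P.PosDef) (hQ : Q.PosDef)
    (Acl : Matrix (Fin n) (Fin n) ℝ) (D : Matrix (Fin n) (Fin p) ℝ) (hD : D ≠ 0)
    (hinv : ∀ (x : Fin n → ℝ) (ω : Fin p → ℝ),
      ω ⬝ᵥ (Q *ᵥ ω) ≤ 1 → x ⬝ᵥ (P *ᵥ x) = 1 →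
        x ⬝ᵥ (P *ᵥ (Acl *ᵥ x + D *ᵥ ω)) ≤ 0) :
    ∃ β : ℝ, 0 < β ∧
      (-(fromBlocks (P * Acl + Aclᵀ * P + β • P) (P * D) (Dᵀ * P) (-β • Q))).PosSemidef := by
  have hPt : Pᵀ = P := hP.isHermitian
  have hQt : Qᵀ = Q := hQ.isHermitian
  have hPpos {x : Fin n → ℝ} (hx : x ≠ 0) : 0 < x ⬝ᵥ (P *ᵥ x) := by
    simpa using hP.dotProduct_mulVec_pos hx
  have hQpos {w : Fin p → ℝ} (hw : w ≠ 0) : 0 < w ⬝ᵥ (Q *ᵥ w) := by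
    simpa using hQ.dotProduct_mulVec_pos hw
  have hQnn (w : Fin p → ℝ) : 0 ≤ w ⬝ᵥ (Q *ᵥ w) := by
    simpa using hQ.posSemidef.dotProduct_mulVec_nonneg w
  have hdet : IsUnit Q.det := (Matrix.isUnit_iff_isUnit_det Q).1 hQ.isUnit
  let u (x : Fin n → ℝ) : Fin p → ℝ := Q⁻¹ *ᵥ (Dᵀ *ᵥ (P *ᵥ x))
  have hQu (x : Fin n → ℝ) : Q *ᵥ u x = Dᵀ *ᵥ (P *ᵥ x) := by
    simp [u, Matrix.mulVec_mulVec, Matrix.mul_nonsing_inv_cancel_left _ _ hdet]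
  have hpair (x : Fin n → ℝ) (w : Fin p → ℝ) :
      w ⬝ᵥ (Q *ᵥ u x) = x ⬝ᵥ (P *ᵥ (D *ᵥ w)) := by
    rw [hQu, Matrix.dotProduct_mulVec, Matrix.vecMul_transpose, Matrix.dotProduct_mulVec x,
      ← Matrix.mulVec_transpose, hPt, dotProduct_comm]
  have hm (x : Fin n → ℝ) :
      (P * D * Q⁻¹ * Dᵀ * P).toQuadraticForm' x = u x ⬝ᵥ (Q *ᵥ u x) := by
    rw [hpair, Matrix.toQuadraticForm'_apply_eq_dotProduct]
    simp [u, Matrix.mulVec_mulVec, Matrix.mul_assoc]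
  have hs (x : Fin n → ℝ) :
      (-(P * Acl)).toQuadraticForm' x = -(x ⬝ᵥ (P *ᵥ (Acl *ᵥ x))) := by
    simp [Matrix.toQuadraticForm'_apply_eq_dotProduct, Matrix.neg_mulVec, Matrix.mulVec_mulVec]
  have hbound (x : Fin n → ℝ) (hx : x ≠ 0) (w : Fin p → ℝ)
      (hw : w ⬝ᵥ (Q *ᵥ w) ≤ x ⬝ᵥ (P *ᵥ x)) :
      x ⬝ᵥ (P *ᵥ (Acl *ᵥ x)) + x ⬝ᵥ (P *ᵥ (D *ᵥ w)) ≤ 0 := by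
    have he := hPpos hx
    set e := x ⬝ᵥ (P *ᵥ x) with hedef
    have hc : (√e)⁻¹ * (√e)⁻¹ = e⁻¹ := by
      rw [← mul_inv, Real.mul_self_sqrt he.le]
    have h := hinv ((√e)⁻¹ • x) ((√e)⁻¹ • w)
      (by
        simp only [Matrix.mulVec_smul, smul_dotProduct, dotProduct_smul, smul_eq_mul]
        rw [← mul_assoc, hc, inv_mul_le_iff₀ he]
        simpa using hw)
      (by
        simp only [Matrix.mulVec_smul, smul_dotProduct, dotProduct_smul, smul_eq_mul]
        rw [← mul_assoc, hc, ← hedef, inv_mul_cancel₀ he.ne'])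
    simp only [Matrix.mulVec_smul, ← smul_add, smul_dotProduct, dotProduct_smul, smul_eq_mul] at h
    rw [← mul_assoc, hc, Matrix.mulVec_add, dotProduct_add] at h
    exact nonpos_of_mul_nonpos_right h (inv_pos.2 he)
  obtain ⟨β, hβ, hmain⟩ := QuadraticForm.exists_pos_forall_quadratic_nonpos
    P.toQuadraticForm' (-(P * Acl)).toQuadraticForm' (P * D * Q⁻¹ * Dᵀ * P).toQuadraticForm'
    hP.toQuadraticForm'
    (fun x => by
      rcases eq_or_ne x 0 with rfl | hx
      · simp
      have h := hbound x hx 0 (by simpa using (hPpos hx).le)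
      rw [hs]
      simp at h ⊢
      linarith)
    (fun x => by
      rcases eq_or_ne x 0 with rfl | hx
      · simp
      rw [hm, hs, Matrix.toQuadraticForm'_apply_eq_dotProduct]
      rcases (hQnn (u x)).eq_or_lt with h0 | hpos
      · rw [← h0, zero_mul]
        positivity
      have he := hPpos hx
      set e := x ⬝ᵥ (P *ᵥ x) with hedef
      set m := u x ⬝ᵥ (Q *ᵥ u x) with hmdef
      have hsq : √(e / m) * √(e / m) = e / m := Real.mul_self_sqrt (by positivity)
      have h := hbound x hx (√(e / m) • u x) (by
        simp only [Matrix.mulVec_smul, smul_dotProduct, dotProduct_smul, smul_eq_mul]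
        rw [← mul_assoc, hsq, ← hmdef, div_mul_cancel₀ _ hpos.ne'])
      simp only [Matrix.mulVec_smul, dotProduct_smul, smul_eq_mul] at h
      rw [← hpair, ← hmdef] at h
      have hle : √(e / m) * m ≤ -(x ⬝ᵥ (P *ᵥ (Acl *ᵥ x))) := by linarith
      calc m * e = (√(e / m) * m) ^ 2 := by
            rw [mul_pow, sq √(e / m), hsq]
            field_simp
        _ ≤ _ := pow_le_pow_left₀ (by positivity) hle 2)
    (by
      by_contra! hcon
      apply hD
      have hu (x : Fin n → ℝ) : u x = 0 := by
        by_contra hne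
        have h := hcon x
        rw [hm] at h
        exact h.not_gt (hQpos hne)
      have hz : Dᵀ * P = 0 := by
        refine Matrix.ext_iff_mulVec.2 fun x => ?_
        rw [← Matrix.mulVec_mulVec, ← hQu, hu]
        simp
      have hPdet : IsUnit P.det := (Matrix.isUnit_iff_isUnit_det P).1 hP.isUnit
      have hDt : Dᵀ = 0 := by
        rw [← Matrix.mul_nonsing_inv_cancel_right (A := P) Dᵀ hPdet, hz, Matrix.zero_mul]
      simpa using congrArg Matrix.transpose hDt)
  refine ⟨β, hβ, Matrix.PosSemidef.of_dotProduct_mulVec_nonneg ?_ fun z => ?_⟩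
  · refine Matrix.IsHermitian.neg ?_
    refine Matrix.IsHermitian.fromBlocks ?_ ?_ ?_
    · simp [Matrix.IsHermitian, Matrix.conjTranspose_eq_transpose_of_trivial, hPt, add_comm]
    · simp [Matrix.conjTranspose_eq_transpose_of_trivial, hPt]
    · simp [Matrix.IsHermitian, Matrix.conjTranspose_eq_transpose_of_trivial, hQt]
  · obtain ⟨x, w, rfl⟩ : ∃ x w, z = Sum.elim x w :=
      ⟨z ∘ Sum.inl, z ∘ Sum.inr, (Sum.elim_comp_inl_inr z).symm⟩
    have hx := hmain x
    rw [hm, hs, Matrix.toQuadraticForm'_apply_eq_dotProduct] at hx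
    have hA : x ⬝ᵥ (Aclᵀ *ᵥ (P *ᵥ x)) = x ⬝ᵥ (P *ᵥ (Acl *ᵥ x)) := by
      rw [Matrix.dotProduct_mulVec, Matrix.vecMul_transpose, Matrix.dotProduct_mulVec x,
        ← Matrix.mulVec_transpose, hPt, dotProduct_comm]
    have hsym : u x ⬝ᵥ (Q *ᵥ w) = x ⬝ᵥ (P *ᵥ (D *ᵥ w)) := by
      rw [← hpair, Matrix.dotProduct_mulVec, ← Matrix.mulVec_transpose, hQt, dotProduct_comm]
    have hsq := hQnn (u x - β • w)
    simp only [Matrix.mulVec_sub, Matrix.mulVec_smul, sub_dotProduct, dotProduct_sub,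
      smul_dotProduct, dotProduct_smul, smul_eq_mul, hsym, hpair x w] at hsq
    have hD' : w ⬝ᵥ (Dᵀ *ᵥ (P *ᵥ x)) = x ⬝ᵥ (P *ᵥ (D *ᵥ w)) := by rw [← hQu, hpair]
    simp only [star_trivial, Matrix.neg_mulVec, dotProduct_neg, Matrix.fromBlocks_mulVec,
      Sum.elim_comp_inl, Sum.elim_comp_inr, sumElim_dotProduct_sumElim, Matrix.add_mulVec,
      ← Matrix.mulVec_mulVec, Matrix.smul_mulVec, dotProduct_add, dotProduct_smul, smul_eq_mul,
      hA, hD']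
    refine nonneg_of_mul_nonneg_left (b := β) ?_ hβ
    linarith
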